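/- Let L ∈ B(H,G) satisfy 0 < ‖L‖ ≤ 1, let g : G → (−∞,+∞] be proper with a continuous affine minorant, let γ > 0, and let ρ > 0. Then: (i) env_ρ(L ⊚_{γ+ρ} g) = L ⊚_γ (env_ρ g); (ii) env_γ(L ⊚_γ g) = env_γ(g**) ∘ L. -/

import Mathlib

open scoped RealInnerProductSpace
open Filter Set

noncomputable section

/-- Fenchel (Legendre) conjugate of an extended-real-valued function. -/
def fconj {H : Type*} [NormedAddCommGroup H] [InnerProductSpace ℝ H]
    (f : H → EReal) : H → EReal :=
  fun xs => ⨆ x : H, (⟪x, xs⟫ : EReal) - f x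

/-- Moreau envelope of index `γ`. -/
def menv {H : Type*} [NormedAddCommGroup H] (γ : ℝ) (f : H → EReal) : H → EReal :=
  fun x => ⨅ y : H, f y + ((‖x - y‖ ^ 2 / (2 * γ) : ℝ) : EReal)

/-- Quadratic kernel `Q`. -/
def qk {H : Type*} [NormedAddCommGroup H] (x : H) : ℝ := ‖x‖ ^ 2 / 2

/-- Proximal composition `L ⊙_γ g`. -/
def proxComp {H G : Type*} [NormedAddCommGroup H] [InnerProductSpace ℝ H]
    [NormedAddCommGroup G] [InnerProductSpace ℝ G]
    (L : H →L[ℝ] G) (γ : ℝ) (g : G → EReal) : H → EReal :=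
  fun x => fconj (fun z => menv (1 / γ) (fconj g) (L z)) x - (((1 / γ) * qk x : ℝ) : EReal)

/-- Proximal cocomposition `L ⊚_γ g`. -/
def proxCocomp {H G : Type*} [NormedAddCommGroup H] [InnerProductSpace ℝ H]
    [NormedAddCommGroup G] [InnerProductSpace ℝ G]
    (L : H →L[ℝ] G) (γ : ℝ) (g : G → EReal) : H → EReal :=
  fconj (proxComp L (1 / γ) (fconj g))

/-- `f` is proper: not identically `+∞` and never `−∞`. -/
def ProperE {H : Type*} (f : H → EReal) : Prop :=
  (∃ x, f x ≠ ⊤) ∧ ∀ x, f x ≠ ⊥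

/-- `f` admits a continuous affine minorant. -/
def HasAffMinorant {H : Type*} [NormedAddCommGroup H] [InnerProductSpace ℝ H]
    (f : H → EReal) : Prop :=
  ∃ (u : H) (c : ℝ), ∀ x, ((⟪x, u⟫ + c : ℝ) : EReal) ≤ f x

/-- Convexity for extended-real-valued functions. -/
def ConvexE {H : Type*} [NormedAddCommGroup H] [InnerProductSpace ℝ H]
    (f : H → EReal) : Prop :=
  ∀ x y : H, ∀ a b : ℝ, 0 < a → 0 < b → a + b = 1 →
    f (a • x + b • y) ≤ ((a : ℝ) : EReal) * f x + ((b : ℝ) : EReal) * f y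

/-- The class `Γ₀`: proper, lower semicontinuous, convex. -/
def IsGamma0 {H : Type*} [NormedAddCommGroup H] [InnerProductSpace ℝ H]
    (f : H → EReal) : Prop :=
  ProperE f ∧ LowerSemicontinuous f ∧ ConvexE f

/-- `p` is a proximal point of `f` at `x`. -/
def IsProx {H : Type*} [NormedAddCommGroup H] (f : H → EReal) (x p : H) : Prop :=
  ∀ y : H, f p + ((‖x - p‖ ^ 2 / 2 : ℝ) : EReal) ≤ f y + ((‖x - y‖ ^ 2 / 2 : ℝ) : EReal)

/-- Subdifferential. -/
def SubdiffE {H : Type*} [NormedAddCommGroup H] [InnerProductSpace ℝ H]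
    (f : H → EReal) (x : H) : Set H :=
  {xs | ∀ y : H, (⟪y - x, xs⟫ : EReal) + f x ≤ f y}

/-- Recession function. -/
def recE {H : Type*} [NormedAddCommGroup H] (f : H → EReal) : H → EReal :=
  fun x => ⨆ y : {y : H // f y ≠ ⊤}, f (x + (y : H)) - f (y : H)

end

section FenchelConjugate

variable {H : Type*} [NormedAddCommGroup H] [InnerProductSpace ℝ H]

theorem inner_sub_le_fconj (f : H → EReal) (x u : H) : (⟪x, u⟫ : EReal) - f x ≤ fconj f u :=
  le_iSup (fun x : H => (⟪x, u⟫ : EReal) - f x) x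

theorem EReal.coe_sub_le_comm {a : ℝ} {b c : EReal} (h : (a : EReal) - b ≤ c) :
    (a : EReal) - c ≤ b := by
  induction b <;> induction c <;> try (simp_all; done)
  all_goals simp only [← EReal.coe_sub, EReal.coe_le_coe_iff, le_bot_iff, EReal.coe_ne_bot] at h ⊢
  linarith

theorem fconj_fconj_le (f : H → EReal) (x : H) : fconj (fconj f) x ≤ f x := by
  refine iSup_le fun u => EReal.coe_sub_le_comm ?_
  rw [real_inner_comm]
  exact inner_sub_le_fconj f x u

theorem fconj_antitone : Antitone (fconj : (H → EReal) → H → EReal) :=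
  fun _ _ hfg _ => iSup_mono fun x => EReal.sub_le_sub le_rfl (hfg x)

theorem fconj_fconj_fconj (f : H → EReal) : fconj (fconj (fconj f)) = fconj f :=
  le_antisymm (fconj_fconj_le (fconj f)) (fconj_antitone (fconj_fconj_le f))

theorem fconj_coe_le {φ : H → ℝ} {u : H} {r : ℝ} (h : ∀ x, ⟪x, u⟫ - φ x ≤ r) :
    fconj (fun x => (φ x : EReal)) u ≤ r :=
  iSup_le fun x => by
    rw [← EReal.coe_sub]
    exact_mod_cast h x

theorem le_fconj_coe {φ : H → ℝ} {u : H} {r : ℝ} (x : H) (h : r ≤ ⟪x, u⟫ - φ x) :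
    (r : EReal) ≤ fconj (fun x => (φ x : EReal)) u := by
  refine le_trans ?_ (inner_sub_le_fconj _ x u)
  rw [← EReal.coe_sub]
  exact_mod_cast h

theorem EReal.coe_sub_sub_coe_le {a b r : ℝ} {X : EReal} (h : ((a + b - r : ℝ) : EReal) ≤ X) :
    (a : EReal) - (X - b) ≤ r := by
  induction X
  · exact absurd (le_bot_iff.1 h) (EReal.coe_ne_bot _)
  · rw [← EReal.coe_sub, ← EReal.coe_sub]
    rw [EReal.coe_le_coe_iff] at h ⊢
    linarith
  · simp

theorem EReal.le_coe_sub_sub_coe {a b r : ℝ} {X : EReal} (h : X ≤ ((a + b - r : ℝ) : EReal)) :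
    (r : EReal) ≤ (a : EReal) - (X - b) := by
  induction X
  · simp
  · rw [← EReal.coe_sub, ← EReal.coe_sub]
    rw [EReal.coe_le_coe_iff] at h ⊢
    linarith
  · exact absurd (top_le_iff.1 h) (EReal.coe_ne_top _)

end FenchelConjugate

section MoreauEnvelope

variable {H : Type*} [NormedAddCommGroup H]

theorem menv_le (γ : ℝ) (f : H → EReal) (x y : H) :
    menv γ f x ≤ f y + ((‖x - y‖ ^ 2 / (2 * γ) : ℝ) : EReal) :=
  iInf_le (fun y : H => f y + ((‖x - y‖ ^ 2 / (2 * γ) : ℝ) : EReal)) y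

theorem properE_of_menv_eq_coe {γ : ℝ} {f : H → EReal} {φ : H → ℝ}
    (h : menv γ f = fun x => (φ x : EReal)) : ProperE f := by
  constructor
  · by_contra! hcon
    have := congrFun h 0
    simp [menv, hcon] at this
  · intro y hy
    have := menv_le γ f y y
    rw [h, hy, EReal.bot_add] at this
    simp at this

theorem EReal.le_add_coe_iff {a b : EReal} {c : ℝ} : a ≤ b + c ↔ a - c ≤ b := by
  rw [EReal.sub_le_iff_le_add (Or.inl (EReal.coe_ne_bot c)) (Or.inl (EReal.coe_ne_top c))]

variable [InnerProductSpace ℝ H]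

theorem norm_add_sq_div_add_le {γ ρ : ℝ} (hγ : 0 < γ) (hρ : 0 < ρ) (a b : H) :
    ‖a + b‖ ^ 2 / (2 * (γ + ρ)) ≤ ‖b‖ ^ 2 / (2 * ρ) + ‖a‖ ^ 2 / (2 * γ) := by
  have h : 0 ≤ ‖ρ • a - γ • b‖ ^ 2 := sq_nonneg _
  rw [norm_sub_sq_real, norm_smul, norm_smul, inner_smul_left, inner_smul_right,
    Real.norm_of_nonneg hγ.le, Real.norm_of_nonneg hρ.le] at h
  simp only [conj_trivial] at h
  rw [norm_add_sq_real, div_add_div _ _ (by positivity) (by positivity),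
    div_le_div_iff₀ (by positivity) (by positivity)]
  nlinarith [h]

theorem menv_menv {γ ρ : ℝ} (hγ : 0 < γ) (hρ : 0 < ρ) (f : H → EReal) :
    menv γ (menv ρ f) = menv (γ + ρ) f := by
  funext x
  apply le_antisymm
  · refine le_iInf fun y => ?_
    have hσ : γ + ρ ≠ 0 := by positivity
    have hy : y + (ρ / (γ + ρ)) • (x - y) - y = (ρ / (γ + ρ)) • (x - y) := by abel
    have hx : x - (y + (ρ / (γ + ρ)) • (x - y)) = (γ / (γ + ρ)) • (x - y) := by
      rw [show γ / (γ + ρ) = 1 - ρ / (γ + ρ) by field_simp; ring, sub_smul, one_smul]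
      abel
    refine (menv_le γ _ x (y + (ρ / (γ + ρ)) • (x - y))).trans
      ((add_le_add_left (menv_le ρ f _ y) _).trans (le_of_eq ?_))
    rw [add_assoc, ← EReal.coe_add, hx, hy, norm_smul, norm_smul,
      Real.norm_of_nonneg (by positivity), Real.norm_of_nonneg (by positivity)]
    congr 2
    field_simp
    ring
  · refine le_iInf fun z => EReal.le_add_coe_iff.2 (le_iInf fun y => EReal.le_add_coe_iff.1 ?_)
    refine (menv_le _ f x y).trans ?_
    rw [add_assoc, ← EReal.coe_add]
    refine add_le_add_right (EReal.coe_le_coe_iff.2 ?_) _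
    simpa using norm_add_sq_div_add_le hγ hρ (x - z) (z - y)

theorem inner_le_norm_sq_div_add {γ : ℝ} (hγ : 0 < γ) (a u : H) :
    ⟪a, u⟫ ≤ ‖a‖ ^ 2 / (2 * γ) + γ * qk u := by
  have h : 0 ≤ ‖a - γ • u‖ ^ 2 / (2 * γ) := by positivity
  rw [norm_sub_sq_real, norm_smul, inner_smul_right, Real.norm_of_nonneg hγ.le] at h
  have h' : (‖a‖ ^ 2 - 2 * (γ * ⟪a, u⟫) + (γ * ‖u‖) ^ 2) / (2 * γ)
      = ‖a‖ ^ 2 / (2 * γ) - ⟪a, u⟫ + γ * (‖u‖ ^ 2 / 2) := by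
    field_simp
  unfold qk
  linarith

theorem fconj_menv {ρ : ℝ} (hρ : 0 < ρ) (f : H → EReal) :
    fconj (menv ρ f) = fun u => fconj f u + ((ρ * qk u : ℝ) : EReal) := by
  funext u
  apply le_antisymm
  · refine iSup_le fun x => EReal.coe_sub_le_comm (le_iInf fun y => ?_)
    have h := inner_sub_le_fconj f y u
    have hxy := inner_le_norm_sq_div_add hρ (x - y) u
    rw [inner_sub_left] at hxy
    refine le_trans ?_ (add_le_add_left (EReal.coe_sub_le_comm h) _)
    induction fconj f u
    · simp
    · simp only [← EReal.coe_sub, ← EReal.coe_add, EReal.coe_le_coe_iff]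
      linarith
    · rw [EReal.top_add_coe, EReal.sub_top]
      exact bot_le
  · suffices h : fconj f u ≤ fconj (menv ρ f) u - ((ρ * qk u : ℝ) : EReal) by
      refine (add_le_add_left h _).trans (le_of_eq ?_)
      exact EReal.sub_add_cancel
    refine iSup_le fun y => ?_
    have h := inner_sub_le_fconj (menv ρ f) (y + ρ • u) u
    have hy := menv_le ρ f (y + ρ • u) y
    have hd : ‖y + ρ • u - y‖ ^ 2 / (2 * ρ) = ρ * qk u := by
      rw [add_sub_cancel_left, norm_smul, Real.norm_of_nonneg hρ.le, qk]
      field_simp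
    have hi : ⟪y + ρ • u, u⟫ = ⟪y, u⟫ + 2 * (ρ * qk u) := by
      rw [inner_add_left, real_inner_smul_left, real_inner_self_eq_norm_sq, qk]
      ring
    rw [hd] at hy
    rw [hi] at h
    refine le_trans (le_of_eq ?_)
      (EReal.sub_le_sub ((EReal.sub_le_sub le_rfl hy).trans h) le_rfl)
    induction f y
    · rw [EReal.bot_add, EReal.coe_sub_bot, EReal.coe_sub_bot, EReal.top_sub_coe]
    · simp only [← EReal.coe_sub, ← EReal.coe_add]
      congr 1
      ring
    · rw [EReal.top_add_coe, EReal.sub_top, EReal.sub_top, EReal.bot_sub]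

theorem fconj_eq_of_menv_eq {γ : ℝ} (hγ : 0 < γ) {f g : H → EReal} (h : menv γ f = menv γ g) :
    fconj f = fconj g := by
  have h' := congrArg fconj h
  rw [fconj_menv hγ, fconj_menv hγ] at h'
  funext u
  have hu := congrArg (· - ((γ * qk u : ℝ) : EReal)) (congrFun h' u)
  simpa only [EReal.add_sub_cancel_right] using hu

end MoreauEnvelope

section QuadraticSmoothness

variable {H : Type*} [NormedAddCommGroup H] [InnerProductSpace ℝ H]

/-- Every point has a subgradient, and the associated affine minorant is exact up to the quadratic
error `‖z - x‖ ^ 2 / (2 * γ)`; that is, `φ` is convex and `1 / γ`-smooth. -/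
def QuadSmooth (γ : ℝ) (φ : H → ℝ) : Prop :=
  ∀ x, ∃ u : H, ∀ z, φ x + ⟪z - x, u⟫ ≤ φ z ∧
    φ z ≤ φ x + ⟪z - x, u⟫ + ‖z - x‖ ^ 2 / (2 * γ)

theorem QuadSmooth.mono {γ σ : ℝ} {φ : H → ℝ} (h : QuadSmooth σ φ) (hγ : 0 < γ) (hγσ : γ ≤ σ) :
    QuadSmooth γ φ := by
  intro x
  obtain ⟨u, hu⟩ := h x
  refine ⟨u, fun z => ⟨(hu z).1, (hu z).2.trans ?_⟩⟩
  gcongr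

theorem QuadSmooth.fconj_fconj {γ : ℝ} {φ : H → ℝ} (h : QuadSmooth γ φ) :
    fconj (fconj fun x => (φ x : EReal)) = fun x => (φ x : EReal) := by
  funext x
  refine le_antisymm (fconj_fconj_le _ x) ?_
  obtain ⟨u, hu⟩ := h x
  have hle : fconj (fun x => (φ x : EReal)) u ≤ ((⟪x, u⟫ - φ x : ℝ) : EReal) := by
    refine fconj_coe_le fun z => ?_
    have := (hu z).1
    rw [inner_sub_left] at this
    linarith
  refine le_trans ?_ (inner_sub_le_fconj _ u x)
  refine le_trans (le_of_eq ?_) (EReal.sub_le_sub le_rfl hle)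
  rw [← EReal.coe_sub, real_inner_comm]
  congr 1
  ring

theorem QuadSmooth.comp {G : Type*} [NormedAddCommGroup G] [InnerProductSpace ℝ G]
    [CompleteSpace H] [CompleteSpace G] {γ : ℝ} (hγ : 0 < γ) {φ : G → ℝ} (h : QuadSmooth γ φ)
    (L : H →L[ℝ] G) (hL : ‖L‖ ≤ 1) : QuadSmooth γ fun x => φ (L x) := by
  intro x
  obtain ⟨u, hu⟩ := h (L x)
  refine ⟨ContinuousLinearMap.adjoint L u, fun z => ?_⟩
  rw [ContinuousLinearMap.adjoint_inner_right, map_sub]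
  refine ⟨(hu (L z)).1, (hu (L z)).2.trans ?_⟩
  rw [← map_sub]
  gcongr
  exact (L.le_of_opNorm_le hL _).trans_eq (one_mul _)

theorem QuadSmooth.menv_fconj_fconj_sub {γ : ℝ} (hγ : 0 < γ) {φ : H → ℝ} (h : QuadSmooth γ φ) :
    menv γ (fconj fun u => fconj (fun x => (φ x : EReal)) u - ((γ * qk u : ℝ) : EReal)) =
      fun x => (φ x : EReal) := by
  funext x
  obtain ⟨u, hu⟩ := h x
  apply le_antisymm
  · have hle : fconj (fun u => fconj (fun x => (φ x : EReal)) u - ((γ * qk u : ℝ) : EReal))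
        (x - γ • u) ≤ ((φ x - γ * qk u : ℝ) : EReal) := by
      refine iSup_le fun v => EReal.coe_sub_sub_coe_le (le_fconj_coe (x + γ • (v - u)) ?_)
      have hz := (hu (x + γ • (v - u))).2
      rw [add_sub_cancel_left, norm_smul, Real.norm_of_nonneg hγ.le, mul_pow,
        norm_sub_sq_real] at hz
      have hd : γ ^ 2 * (‖v‖ ^ 2 - 2 * ⟪v, u⟫ + ‖u‖ ^ 2) / (2 * γ)
          = γ * (‖v‖ ^ 2 - 2 * ⟪v, u⟫ + ‖u‖ ^ 2) / 2 := by field_simp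
      rw [hd] at hz
      rw [real_inner_comm (x - γ • u) v]
      simp only [inner_sub_left, inner_add_left, real_inner_smul_left,
        real_inner_self_eq_norm_sq, real_inner_comm u v, qk] at hz ⊢
      linarith
    refine (menv_le _ _ x (x - γ • u)).trans ((add_le_add_left hle _).trans ?_)
    rw [← EReal.coe_add, EReal.coe_le_coe_iff, sub_sub_cancel, norm_smul,
      Real.norm_of_nonneg hγ.le, qk]
    apply le_of_eq
    field_simp
    ring
  · refine le_iInf fun y => ?_
    have hle : ((⟪y - x, u⟫ + φ x + γ * qk u : ℝ) : EReal) ≤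
        fconj (fun u => fconj (fun x => (φ x : EReal)) u - ((γ * qk u : ℝ) : EReal)) y := by
      refine le_trans (EReal.le_coe_sub_sub_coe (fconj_coe_le fun z => ?_))
        (inner_sub_le_fconj
          (fun u => fconj (fun x => (φ x : EReal)) u - ((γ * qk u : ℝ) : EReal)) u y)
      have hz := (hu z).1
      simp only [inner_sub_left] at hz ⊢
      rw [real_inner_comm y u]
      linarith
    refine le_trans ?_ (add_le_add_left hle _)
    rw [← EReal.coe_add, EReal.coe_le_coe_iff]
    have := inner_le_norm_sq_div_add hγ (x - y) u
    rw [← neg_sub x y, inner_neg_left]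
    linarith

end QuadraticSmoothness

section Prox

variable {H : Type*} [NormedAddCommGroup H] [InnerProductSpace ℝ H]

theorem le_of_forall_mul_sq_le {a b : ℝ} (h : ∀ l : ℝ, 0 < l → l < 1 → 0 ≤ l * a + l ^ 2 * b) :
    0 ≤ a := by
  by_contra! ha
  set l := min (1 / 2) (-a / (2 * (|b| + 1))) with hl
  have hb : 0 < |b| + 1 := by positivity
  have hl0 : 0 < l := lt_min (by norm_num) (div_pos (by linarith) (by positivity))
  have hl1 : l < 1 := (min_le_left _ _).trans_lt (by norm_num)
  have hl2 : l * (2 * (|b| + 1)) ≤ -a := (le_div_iff₀ (by positivity)).1 (min_le_right _ _)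
  have h1 : 0 ≤ a + l * b := by
    refine nonneg_of_mul_nonneg_right (a := l) ?_ hl0
    linarith [h l hl0 hl1]
  nlinarith [le_abs_self b, abs_nonneg b]

/-- Minimizing `s + ‖x - y‖ ^ 2 / (2 * γ)` over a closed convex set of pairs `(y, s)`: the minimizer
exists and satisfies the variational inequality. -/
theorem exists_prox_of_convex [CompleteSpace H] {E : Set (H × ℝ)} (hc : Convex ℝ E)
    (hcl : IsClosed E) (hne : E.Nonempty) {γ : ℝ} (hγ : 0 < γ) (x : H) {B : ℝ}
    (hB : ∀ q ∈ E, B ≤ q.2 + ‖x - q.1‖ ^ 2 / (2 * γ)) :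
    ∃ q ∈ E, ∀ w ∈ E, q.2 + ⟪w.1 - q.1, x - q.1⟫ / γ ≤ w.2 := by
  set F : H × ℝ → ℝ := fun q => q.2 + ‖x - q.1‖ ^ 2 / (2 * γ) with hF
  have hcomb : ∀ q w : H × ℝ, ∀ l : ℝ, F ((1 - l) • q + l • w) =
      (1 - l) * F q + l * F w - l * (1 - l) * (‖q.1 - w.1‖ ^ 2 / (2 * γ)) := by
    intro q w l
    have h1 : x - ((1 - l) • q.1 + l • w.1) = (1 - l) • (x - q.1) + l • (x - w.1) := by
      module
    have h2 : q.1 - w.1 = (x - w.1) - (x - q.1) := by abel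
    simp only [hF, Prod.fst_add, Prod.snd_add, Prod.smul_fst, Prod.smul_snd, smul_eq_mul]
    rw [h1, h2, norm_add_sq_real, norm_sub_sq_real (x - w.1), norm_smul, norm_smul, mul_pow,
      mul_pow, real_inner_smul_left, real_inner_smul_right, Real.norm_eq_abs, Real.norm_eq_abs,
      sq_abs, sq_abs, real_inner_comm (x - q.1) (x - w.1)]
    field_simp
    ring
  have hbdd : BddBelow (F '' E) := ⟨B, by rintro _ ⟨q, hq, rfl⟩; exact hB q hq⟩
  set m := sInf (F '' E) with hm
  have hmle : ∀ q ∈ E, m ≤ F q := fun q hq => csInf_le hbdd ⟨q, hq, rfl⟩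
  have hseq : ∀ n : ℕ, ∃ q ∈ E, F q < m + 1 / ((n : ℝ) + 1) := by
    intro n
    obtain ⟨_, ⟨q, hq, rfl⟩, hlt⟩ := exists_lt_of_csInf_lt (hne.image F)
      (show sInf (F '' E) < m + 1 / ((n : ℝ) + 1) from lt_add_of_pos_right _ (by positivity))
    exact ⟨q, hq, hlt⟩
  choose q hqE hqF using hseq
  have hdist : ∀ n j : ℕ, ‖(q n).1 - (q j).1‖ ^ 2 ≤
      4 * γ * (1 / ((n : ℝ) + 1) + 1 / ((j : ℝ) + 1)) := by
    intro n j
    have h1 := hmle _ (hc (hqE n) (hqE j) (show (0 : ℝ) ≤ 1 - 1 / 2 by norm_num)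
      (show (0 : ℝ) ≤ 1 / 2 by norm_num) (by norm_num))
    rw [hcomb] at h1
    have h2 : ‖(q n).1 - (q j).1‖ ^ 2 / (2 * γ) ≤ 2 * (1 / ((n : ℝ) + 1) + 1 / ((j : ℝ) + 1)) := by
      linarith [hqF n, hqF j]
    rw [div_le_iff₀ (by positivity)] at h2
    linarith
  have hcau : CauchySeq fun n => (q n).1 := by
    refine cauchySeq_of_le_tendsto_0 (fun N : ℕ => √(8 * γ * (1 / ((N : ℝ) + 1)))) ?_ ?_
    · intro n j N hn hj
      rw [dist_eq_norm]
      refine Real.le_sqrt_of_sq_le ((hdist n j).trans ?_)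
      have h1 : 1 / ((n : ℝ) + 1) ≤ 1 / ((N : ℝ) + 1) := by gcongr
      have h2 : 1 / ((j : ℝ) + 1) ≤ 1 / ((N : ℝ) + 1) := by gcongr
      nlinarith
    · have := ((tendsto_one_div_add_atTop_nhds_zero_nat (𝕜 := ℝ)).const_mul (8 * γ)).sqrt
      simpa using this
  obtain ⟨p, hp⟩ := cauchySeq_tendsto_of_complete hcau
  have hFm : Tendsto (fun n => F (q n)) atTop (nhds m) := by
    refine tendsto_of_tendsto_of_tendsto_of_le_of_le tendsto_const_nhds ?_
      (fun n => hmle _ (hqE n)) (fun n => (hqF n).le)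
    simpa using (tendsto_one_div_add_atTop_nhds_zero_nat (𝕜 := ℝ)).const_add m
  have ht : Tendsto (fun n => (q n).2) atTop (nhds (m - ‖x - p‖ ^ 2 / (2 * γ))) := by
    have := hFm.sub ((((tendsto_const_nhds (x := x)).sub hp).norm.pow 2).div_const (2 * γ))
    simpa [hF] using this
  have hpE : (p, m - ‖x - p‖ ^ 2 / (2 * γ)) ∈ E :=
    hcl.mem_of_tendsto (hp.prodMk_nhds ht) (Eventually.of_forall hqE)
  refine ⟨_, hpE, fun w hw => ?_⟩
  set P : H × ℝ := (p, m - ‖x - p‖ ^ 2 / (2 * γ)) with hP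
  have hFP : F P = m := by simp [hF, hP]
  have key : 0 ≤ F w - m - ‖P.1 - w.1‖ ^ 2 / (2 * γ) := by
    refine le_of_forall_mul_sq_le (b := ‖P.1 - w.1‖ ^ 2 / (2 * γ)) fun l h0 h1 => ?_
    have := hmle _ (hc hpE hw (sub_nonneg.2 h1.le) h0.le (by ring))
    rw [hcomb, hFP] at this
    linarith
  have hexp : ‖x - w.1‖ ^ 2 / (2 * γ) = ‖x - P.1‖ ^ 2 / (2 * γ) -
      ⟪w.1 - P.1, x - P.1⟫ / γ + ‖P.1 - w.1‖ ^ 2 / (2 * γ) := by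
    rw [show x - w.1 = (x - P.1) - (w.1 - P.1) by abel, norm_sub_sq_real,
      norm_sub_rev P.1 w.1, real_inner_comm]
    field_simp
  simp only [hF] at key hFP
  linarith

/-- The Moreau envelope of a proper conjugate function is real-valued, convex and smooth. -/
theorem exists_quadSmooth_menv_fconj [CompleteSpace H] (k : H → EReal)
    (htop : ∃ x, fconj k x ≠ ⊤) (hbot : ∀ x, fconj k x ≠ ⊥) {γ : ℝ} (hγ : 0 < γ) :
    ∃ e : H → ℝ, QuadSmooth γ e ∧ menv γ (fconj k) = fun x => (e x : EReal) := by
  set E : Set (H × ℝ) := {q | fconj k q.1 ≤ q.2} with hE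
  have hmem : E = ⋂ (v : H) (c : ℝ) (_ : k v ≤ c), {q : H × ℝ | ⟪q.1, v⟫ - c ≤ q.2} := by
    ext q
    simp only [hE, mem_ofPred_eq, mem_iInter, fconj, iSup_le_iff]
    refine forall_congr' fun v => ?_
    rw [real_inner_comm]
    generalize k v = a
    induction a with
    | bot =>
      simp only [EReal.coe_sub_bot, top_le_iff, EReal.coe_ne_top, bot_le, forall_const, false_iff,
        not_forall, not_le]
      exact ⟨⟪q.1, v⟫ - q.2 - 1, by linarith⟩
    | top => simp
    | coe a =>
      rw [← EReal.coe_sub, EReal.coe_le_coe_iff]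
      refine ⟨fun h c hc => ?_, fun h => h a le_rfl⟩
      have := EReal.coe_le_coe_iff.1 hc
      linarith
  have hconv : Convex ℝ E := by
    rw [hmem]
    refine convex_iInter fun v => convex_iInter fun c => convex_iInter fun _ => ?_
    intro q hq w hw a b ha hb hab
    simp only [mem_ofPred_eq, Prod.fst_add, Prod.snd_add, Prod.smul_fst, Prod.smul_snd, smul_eq_mul,
      inner_add_left, real_inner_smul_left] at *
    nlinarith [mul_le_mul_of_nonneg_left hq ha, mul_le_mul_of_nonneg_left hw hb,
      congrArg (c * ·) hab]
  have hclosed : IsClosed E := by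
    rw [hmem]
    refine isClosed_iInter fun v => isClosed_iInter fun c => isClosed_iInter fun _ => ?_
    exact isClosed_le (by fun_prop) (by fun_prop)
  have hreal : ∀ y, fconj k y ≠ ⊤ → (y, (fconj k y).toReal) ∈ E := fun y hy =>
    (EReal.coe_toReal hy (hbot y)).ge
  obtain ⟨x₀, hx₀⟩ := htop
  have hv : ∃ (v : H) (c : ℝ), k v ≤ c := by
    by_contra! hcon
    refine hbot 0 ?_
    have : ∀ v, k v = ⊤ := fun v => EReal.eq_top_iff_forall_lt _ |>.2 (hcon v)
    simp [fconj, this]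
  obtain ⟨v, c, hvc⟩ := hv
  have hprox : ∀ x, ∃ q ∈ E, ∀ w ∈ E, q.2 + ⟪w.1 - q.1, x - q.1⟫ / γ ≤ w.2 := by
    intro x
    refine exists_prox_of_convex hconv hclosed ⟨_, hreal x₀ hx₀⟩ hγ x
      (B := ⟪x, v⟫ - c - γ * qk v) fun q hq => ?_
    rw [hmem] at hq
    simp only [mem_iInter, mem_ofPred_eq] at hq
    have h1 := hq v c hvc
    have h2 := inner_le_norm_sq_div_add hγ (x - q.1) v
    rw [inner_sub_left] at h2
    linarith
  choose q hqE hq using hprox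
  have hmin : ∀ x, ∀ w ∈ E,
      (q x).2 + ‖x - (q x).1‖ ^ 2 / (2 * γ) ≤ w.2 + ‖x - w.1‖ ^ 2 / (2 * γ) := by
    intro x w hw
    have h1 := hq x w hw
    have h2 : ‖x - w.1‖ ^ 2 / (2 * γ) = ‖x - (q x).1‖ ^ 2 / (2 * γ) -
        ⟪w.1 - (q x).1, x - (q x).1⟫ / γ + ‖w.1 - (q x).1‖ ^ 2 / (2 * γ) := by
      rw [show x - w.1 = (x - (q x).1) - (w.1 - (q x).1) by abel, norm_sub_sq_real,
        real_inner_comm]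
      field_simp
    have h3 : 0 ≤ ‖w.1 - (q x).1‖ ^ 2 / (2 * γ) := by positivity
    linarith
  refine ⟨fun x => (q x).2 + ‖x - (q x).1‖ ^ 2 / (2 * γ), fun x => ⟨γ⁻¹ • (x - (q x).1),
    fun z => ⟨?_, (hmin z _ (hqE x)).trans (le_of_eq ?_)⟩⟩, ?_⟩
  · have h1 := hq x _ (hqE z)
    have h2 := inner_le_norm_sq_div_add hγ (z - (q z).1) (γ⁻¹ • (x - (q x).1))
    have h3 : γ * qk (γ⁻¹ • (x - (q x).1)) = ‖x - (q x).1‖ ^ 2 / (2 * γ) := by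
      rw [qk, norm_smul, norm_inv, Real.norm_of_nonneg hγ.le]
      field_simp
    have h4 : ⟪z - x, γ⁻¹ • (x - (q x).1)⟫ = ⟪(q z).1 - (q x).1, x - (q x).1⟫ / γ +
        ⟪z - (q z).1, γ⁻¹ • (x - (q x).1)⟫ - 2 * (‖x - (q x).1‖ ^ 2 / (2 * γ)) := by
      rw [show z - x = ((q z).1 - (q x).1) + (z - (q z).1) - (x - (q x).1) by abel,
        inner_sub_left, inner_add_left]
      simp only [real_inner_smul_right, real_inner_self_eq_norm_sq]
      field_simp
    linarith
  · rw [show z - (q x).1 = (z - x) + (x - (q x).1) by abel, norm_add_sq_real,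
      real_inner_smul_right]
    field_simp
    ring
  · funext x
    apply le_antisymm
    · refine (menv_le _ _ x (q x).1).trans ?_
      rw [EReal.coe_add]
      exact add_le_add_left (hqE x) _
    · refine le_iInf fun y => ?_
      by_cases hy : fconj k y = ⊤
      · simp [hy]
      · rw [← EReal.coe_toReal hy (hbot y), ← EReal.coe_add, EReal.coe_le_coe_iff]
        exact hmin x _ (hreal y hy)

end Prox

section Biconjugate

variable {H : Type*} [NormedAddCommGroup H] [InnerProductSpace ℝ H]

theorem ProperE.fconj_fconj {g : H → EReal} (hg : ProperE g) (hm : HasAffMinorant g) :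
    ProperE (fconj (fconj g)) := by
  obtain ⟨⟨x₀, hx₀⟩, -⟩ := hg
  obtain ⟨u, c, hu⟩ := hm
  refine ⟨⟨x₀, ne_top_of_le_ne_top hx₀ (fconj_fconj_le g x₀)⟩, fun x => ?_⟩
  have hle : fconj g u ≤ ((-c : ℝ) : EReal) := by
    refine iSup_le fun y => (EReal.sub_le_sub le_rfl (hu y)).trans (le_of_eq ?_)
    rw [← EReal.coe_sub]
    congr 1
    ring
  refine ne_bot_of_le_ne_bot ?_
    ((EReal.sub_le_sub le_rfl hle).trans (inner_sub_le_fconj (fconj g) u x))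
  rw [← EReal.coe_sub]
  exact EReal.coe_ne_bot _

theorem fconj_fconj_menv [CompleteSpace H] {g : H → EReal} (hg : ProperE g)
    (hm : HasAffMinorant g) {ρ : ℝ} (hρ : 0 < ρ) :
    fconj (fconj (menv ρ g)) = menv ρ (fconj (fconj g)) := by
  obtain ⟨htop, hbot⟩ := hg.fconj_fconj hm
  obtain ⟨e, he, hme⟩ := exists_quadSmooth_menv_fconj (fconj g) htop hbot hρ
  rw [fconj_menv hρ, ← fconj_fconj_fconj g, ← fconj_menv hρ, fconj_fconj_fconj g, hme,
    he.fconj_fconj]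

/-- Both sides have the same Moreau envelope of index `γ`, namely `φ`. -/
theorem QuadSmooth.menv_fconj_fconj_sub_add [CompleteSpace H] {γ ρ : ℝ} (hγ : 0 < γ) (hρ : 0 < ρ)
    {φ : H → ℝ} (h : QuadSmooth (γ + ρ) φ) :
    menv ρ (fconj fun u =>
        fconj (fun x => (φ x : EReal)) u - (((γ + ρ) * qk u : ℝ) : EReal)) =
      fconj fun u => fconj (fun x => (φ x : EReal)) u - ((γ * qk u : ℝ) : EReal) := by
  have h₁ := h.menv_fconj_fconj_sub (add_pos hγ hρ)
  have h₂ := (h.mono hγ (le_add_of_nonneg_right hρ.le)).menv_fconj_fconj_sub hγ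
  obtain ⟨htop, hbot⟩ := properE_of_menv_eq_coe h₁
  obtain ⟨e, he, hme⟩ := exists_quadSmooth_menv_fconj _ htop hbot hρ
  rw [← menv_menv hγ hρ] at h₁
  have h₃ := congrArg fconj (fconj_eq_of_menv_eq hγ (h₁.trans h₂.symm))
  rwa [hme, he.fconj_fconj, ← hme, fconj_fconj_fconj] at h₃

theorem proxCocomp_eq {G : Type*} [NormedAddCommGroup G] [InnerProductSpace ℝ G]
    (L : H →L[ℝ] G) (γ : ℝ) (g : G → EReal) :
    proxCocomp L γ g = fconj fun u =>
      fconj (fun x => menv γ (fconj (fconj g)) (L x)) u - ((γ * qk u : ℝ) : EReal) := by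
  unfold proxCocomp proxComp
  rw [one_div_one_div]

end Biconjugate


/-- Moreau envelopes of proximal cocompositions:
`env_ρ(L ⊚_{γ+ρ} g) = L ⊚_γ (env_ρ g)` and `env_γ(L ⊚_γ g) = env_γ(g**) ∘ L`. -/
theorem menv_proxCocomp
    {H G : Type*} [NormedAddCommGroup H] [InnerProductSpace ℝ H] [CompleteSpace H]
    [NormedAddCommGroup G] [InnerProductSpace ℝ G] [CompleteSpace G]
    (L : H →L[ℝ] G) (hL0 : 0 < ‖L‖) (hL1 : ‖L‖ ≤ 1)
    (g : G → EReal) (hg : ProperE g) (hm : HasAffMinorant g)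
    (γ : ℝ) (hγ : 0 < γ) (ρ : ℝ) (hρ : 0 < ρ) :
    menv ρ (proxCocomp L (γ + ρ) g) = proxCocomp L γ (menv ρ g) ∧
    menv γ (proxCocomp L γ g) = fun x : H => menv γ (fconj (fconj g)) (L x) := by
  obtain ⟨htop, hbot⟩ := hg.fconj_fconj hm
  constructor
  · obtain ⟨e, he, hme⟩ := exists_quadSmooth_menv_fconj (fconj g) htop hbot (add_pos hγ hρ)
    rw [proxCocomp_eq, proxCocomp_eq, fconj_fconj_menv hg hm hρ, menv_menv hγ hρ, hme]
    exact (he.comp (add_pos hγ hρ) L hL1).menv_fconj_fconj_sub_add hγ hρ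
  · obtain ⟨e, he, hme⟩ := exists_quadSmooth_menv_fconj (fconj g) htop hbot hγ
    rw [proxCocomp_eq, hme]
    exact (he.comp hγ L hL1).menv_fconj_fconj_sub hγ
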